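/- Let n₀, m ≥ 1 be integers and let v₁, …, v_m ∈ ℝ^{4^{n₀}}. Let ε = (ε₁, …, ε_m) range uniformly over {−1,1}^m. Then: (1) for every 1 ≤ p ≤ 2 with Hölder conjugate p*, the average 2^{−m} ∑_{ε ∈ {−1,1}^m} (1/m)·‖∑_{i=1}^m ε_i v_i‖_{p*} ≤ (√(min{p*, 8n₀})/√m) · max_i ‖v_i‖_{p*}; and (2) for every 2 < p < ∞ with Hölder conjugate p*, the average 2^{−m} ∑_{ε ∈ {−1,1}^m} (1/m)·‖∑_{i=1}^m ε_i v_i‖_{p*} ≤ (√(p*)/m^{1/p}) · max_i ‖v_i‖_{p*}. -/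

import Mathlib

open scoped ENNReal BigOperators
open Matrix

/-- The `l_p` norm of a finitely-indexed real vector, for `0 < p ≤ ∞`
(for `p = ∞` it is the max of the absolute values of the entries). -/
noncomputable def vecLpNorm {ι : Type*} [Fintype ι] (p : ℝ≥0∞) (w : ι → ℝ) : ℝ :=
  if p = ∞ then ⨆ j, |w j| else (∑ j, |w j| ^ p.toReal) ^ (1 / p.toReal)

/-- The `(p,q)` group norm of a real matrix:
`‖M‖_{p,q} = ((1/N₁) ∑_i ‖M_i‖_p^q)^{1/q}`, with `‖M‖_{p,∞} = max_i ‖M_i‖_p`. -/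
noncomputable def groupNorm {ι κ : Type*} [Fintype ι] [Fintype κ]
    (p q : ℝ≥0∞) (M : Matrix ι κ ℝ) : ℝ :=
  if q = ∞ then ⨆ i, vecLpNorm p (M i)
  else ((Fintype.card ι : ℝ)⁻¹ * ∑ i, vecLpNorm p (M i) ^ q.toReal) ^ (1 / q.toReal)

/-- The Hölder conjugate `p*` of a real `p ≥ 1`, as an extended nonnegative real
(so that `1* = ∞`). -/
noncomputable def hconj (p : ℝ) : ℝ≥0∞ :=
  if p = 1 then ∞ else ENNReal.ofReal (p / (p - 1))

/-- `min {p*, 8 n₀}`, interpreted as `8 n₀` when `p* = ∞` (i.e. when `p = 1`). -/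
noncomputable def minConj (p : ℝ) (n₀ : ℕ) : ℝ :=
  if p = 1 then 8 * n₀ else min (p / (p - 1)) (8 * n₀)

/-- The sign `±1` encoded by a Boolean. -/
abbrev boolSign (b : Bool) : ℝ := if b then 1 else -1

/-- The average of `f` over all `m`-tuples of Booleans. -/
noncomputable def signAvg {m : ℕ} (f : (Fin m → Bool) → ℝ) : ℝ :=
  ((2 : ℝ) ^ m)⁻¹ * ∑ ε, f ε

section signAvg

variable {m : ℕ}

lemma signAvg_succ (f : (Fin (m + 1) → Bool) → ℝ) :
    signAvg f = (signAvg (fun ε => f (Fin.cons true ε)) +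
      signAvg (fun ε => f (Fin.cons false ε))) / 2 := by
  have h : ∑ ε, f ε = ∑ b : Bool, ∑ ε : Fin m → Bool, f (Fin.cons b ε) := by
    rw [← Fintype.sum_prod_type']
    exact (Equiv.sum_comp (Fin.consEquiv fun _ => Bool) f).symm
  simp only [signAvg, h, Fintype.sum_bool, pow_succ, mul_inv]
  ring

lemma signAvg_mono {f g : (Fin m → Bool) → ℝ} (h : ∀ ε, f ε ≤ g ε) : signAvg f ≤ signAvg g :=
  mul_le_mul_of_nonneg_left (Finset.sum_le_sum fun ε _ => h ε) (by positivity)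

lemma signAvg_add (f g : (Fin m → Bool) → ℝ) :
    signAvg (fun ε => f ε + g ε) = signAvg f + signAvg g := by
  simp only [signAvg, Finset.sum_add_distrib, mul_add]

lemma signAvg_const_mul (c : ℝ) (f : (Fin m → Bool) → ℝ) :
    signAvg (fun ε => c * f ε) = c * signAvg f := by
  simp only [signAvg, ← Finset.mul_sum]
  ring

lemma signAvg_const (c : ℝ) : signAvg (fun _ : Fin m → Bool => c) = c := by
  simp [signAvg]

lemma signAvg_sum {ι : Type*} [Fintype ι] (f : ι → (Fin m → Bool) → ℝ) :
    signAvg (fun ε => ∑ j, f j ε) = ∑ j, signAvg (f j) := by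
  simp only [signAvg, ← Finset.mul_sum]
  rw [Finset.sum_comm]

lemma signAvg_le_rpow_signAvg {q : ℝ} (hq : 1 ≤ q) {f : (Fin m → Bool) → ℝ}
    (hf : ∀ ε, 0 ≤ f ε) : signAvg f ≤ signAvg (fun ε => f ε ^ q) ^ (1 / q) := by
  simp only [signAvg, Finset.mul_sum]
  exact Real.arith_mean_le_rpow_mean Finset.univ (fun _ => ((2 : ℝ) ^ m)⁻¹) f
    (fun _ _ => by positivity) (by simp) (fun ε _ => hf ε) hq

lemma signAvg_exp_le (a : Fin m → ℝ) :
    signAvg (fun ε => Real.exp (∑ i, boolSign (ε i) * a i)) ≤ Real.exp ((∑ i, a i ^ 2) / 2) := by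
  induction m with
  | zero => simp [signAvg]
  | succ k ih =>
    have h := ih fun i => a i.succ
    rw [signAvg_succ]
    simp only [Fin.sum_univ_succ, Fin.cons_zero, Fin.cons_succ, Real.exp_add, signAvg_const_mul,
      add_div]
    refine le_trans (le_of_eq ?_) (mul_le_mul (Real.cosh_le_exp_half_sq (a 0)) h ?_ ?_)
    · rw [Real.cosh_eq]
      simp
      ring
    · exact mul_nonneg (by positivity) (Finset.sum_nonneg fun _ _ => (Real.exp_pos _).le)
    · positivity

end signAvg

lemma rpow_le_mul_exp {t q : ℝ} (ht : 0 ≤ t) (hq : 0 < q) :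
    t ^ q ≤ (q / Real.exp 1) ^ q * Real.exp t := by
  have h1 : t ≤ q / Real.exp 1 * Real.exp (t / q) := by
    have h := Real.add_one_le_exp (t / q - 1)
    rw [Real.exp_sub] at h
    calc t = q * (t / q) := by field_simp
      _ ≤ q * (Real.exp (t / q) / Real.exp 1) :=
          mul_le_mul_of_nonneg_left (by linarith) hq.le
      _ = _ := by ring
  calc t ^ q ≤ (q / Real.exp 1 * Real.exp (t / q)) ^ q := Real.rpow_le_rpow ht h1 hq.le
    _ = _ := by
      rw [Real.mul_rpow (by positivity) (by positivity), ← Real.exp_mul]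
      field_simp

/-- **Khintchine's inequality** with an explicit constant. -/
lemma signAvg_abs_rpow_le {m : ℕ} {q : ℝ} (hq : 0 < q) (a : Fin m → ℝ) :
    signAvg (fun ε => |∑ i, boolSign (ε i) * a i| ^ q) ≤
      2 * (q / Real.exp 1) ^ (q / 2) * (∑ i, a i ^ 2) ^ (q / 2) := by
  set V := ∑ i, a i ^ 2 with hV
  have hV0 : 0 ≤ V := Finset.sum_nonneg fun _ _ => sq_nonneg _
  rcases hV0.eq_or_lt with h0 | hpos
  · have ha : ∀ i, a i = 0 := fun i => by
      have := (Finset.sum_eq_zero_iff_of_nonneg fun i _ => sq_nonneg (a i)).1 h0.symm i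
        (Finset.mem_univ i)
      simpa using this
    simp only [ha, mul_zero, Finset.sum_const_zero, abs_zero, Real.zero_rpow hq.ne',
      signAvg_const]
    positivity
  set L := √(q / V) with hL
  have hLpos : 0 < L := Real.sqrt_pos.2 (by positivity)
  have hL2 : L ^ 2 * V = q := by
    rw [hL, Real.sq_sqrt (by positivity)]
    field_simp
  have hLq : L ^ q = (q / V) ^ (q / 2) := by
    rw [hL, Real.sqrt_eq_rpow, ← Real.rpow_mul (by positivity)]
    ring_nf
  have hexp : ∀ c : ℝ, c ^ 2 = L ^ 2 →
      signAvg (fun ε => Real.exp (c * ∑ i, boolSign (ε i) * a i)) ≤ Real.exp (q / 2) := by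
    intro c hc
    have h := signAvg_exp_le fun i => c * a i
    simp only [mul_pow, ← Finset.mul_sum, mul_left_comm _ c] at h
    rwa [hc, ← hV, hL2] at h
  have key : L ^ q * signAvg (fun ε => |∑ i, boolSign (ε i) * a i| ^ q) ≤
      (q / Real.exp 1) ^ q * (Real.exp (q / 2) + Real.exp (q / 2)) := by
    calc _ = signAvg (fun ε => L ^ q * |∑ i, boolSign (ε i) * a i| ^ q) :=
          (signAvg_const_mul _ _).symm
      _ ≤ signAvg (fun ε => (q / Real.exp 1) ^ q *
            (Real.exp (L * ∑ i, boolSign (ε i) * a i) +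
              Real.exp (-L * ∑ i, boolSign (ε i) * a i))) := by
          refine signAvg_mono fun ε => ?_
          rw [← Real.mul_rpow hLpos.le (abs_nonneg _)]
          refine (rpow_le_mul_exp (by positivity) hq).trans ?_
          gcongr
          rw [← abs_of_pos hLpos, ← abs_mul, abs_of_pos hLpos, neg_mul]
          exact Real.exp_abs_le _
      _ ≤ _ := by
          rw [signAvg_const_mul, signAvg_add]
          have h1 := hexp L rfl
          have h2 := hexp (-L) (by ring)
          gcongr
  have hconst : (q / Real.exp 1) ^ q * (Real.exp (q / 2) + Real.exp (q / 2)) =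
      L ^ q * (2 * (q / Real.exp 1) ^ (q / 2) * V ^ (q / 2)) := by
    have e1 : (q / Real.exp 1) ^ q = (q / Real.exp 1) ^ (q / 2) * (q / Real.exp 1) ^ (q / 2) := by
      rw [← Real.rpow_add (by positivity)]
      ring_nf
    have e2 : Real.exp (q / 2) = Real.exp 1 ^ (q / 2) := by rw [← Real.exp_mul, one_mul]
    have e3 : (q / Real.exp 1) ^ (q / 2) * Real.exp 1 ^ (q / 2) = q ^ (q / 2) := by
      rw [← Real.mul_rpow (by positivity) (by positivity)]
      field_simp
    have e4 : L ^ q * V ^ (q / 2) = q ^ (q / 2) := by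
      rw [hLq, ← Real.mul_rpow (by positivity) (by positivity)]
      field_simp
    rw [e2, e1]
    linear_combination 2 * (q / Real.exp 1) ^ (q / 2) * (e3 - e4)
  rw [hconst] at key
  exact le_of_mul_le_mul_left key (by positivity)

lemma sq_rpow_half (x q : ℝ) : (x ^ 2) ^ (q / 2) = |x| ^ q := by
  rw [← sq_abs, ← Real.rpow_natCast, ← Real.rpow_mul (abs_nonneg x)]
  congr 1
  push_cast
  ring

lemma sum_sq_rpow_le {m : ℕ} {q : ℝ} (hq : 2 ≤ q) (a : Fin m → ℝ) :
    (∑ i, a i ^ 2) ^ (q / 2) ≤ (m : ℝ) ^ (q / 2 - 1) * ∑ i, |a i| ^ q := by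
  have h := Real.rpow_sum_le_const_mul_sum_rpow_of_nonneg (s := Finset.univ)
    (f := fun i => a i ^ 2) (p := q / 2) (by linarith) (fun i _ => sq_nonneg (a i))
  simpa [sq_rpow_half] using h

lemma abs_add_rpow_add_abs_sub_rpow_le {q : ℝ} (hq : 0 ≤ q) (hq2 : q ≤ 2) (x y : ℝ) :
    (|x + y| ^ q + |-x + y| ^ q) / 2 ≤ |x| ^ q + |y| ^ q := by
  simp only [← sq_rpow_half]
  have hc := (Real.concaveOn_rpow (p := q / 2) (by linarith) (by linarith)).2
    (Set.mem_Ici.2 (sq_nonneg (x + y))) (Set.mem_Ici.2 (sq_nonneg (-x + y)))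
    (one_half_pos.le : (0 : ℝ) ≤ 1 / 2) (one_half_pos.le : (0 : ℝ) ≤ 1 / 2) (by norm_num)
  simp only [smul_eq_mul] at hc
  calc _ = 1 / 2 * ((x + y) ^ 2) ^ (q / 2) + 1 / 2 * ((-x + y) ^ 2) ^ (q / 2) := by ring
    _ ≤ _ := hc
    _ = (x ^ 2 + y ^ 2) ^ (q / 2) := by ring_nf
    _ ≤ _ := Real.rpow_add_le_add_rpow (sq_nonneg _) (sq_nonneg _) (by linarith) (by linarith)

lemma signAvg_abs_rpow_le_sum {m : ℕ} {q : ℝ} (hq : 0 < q) (hq2 : q ≤ 2) (a : Fin m → ℝ) :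
    signAvg (fun ε => |∑ i, boolSign (ε i) * a i| ^ q) ≤ ∑ i, |a i| ^ q := by
  induction m with
  | zero => simp [signAvg, Real.zero_rpow hq.ne']
  | succ k ih =>
    have h := ih fun i => a i.succ
    rw [signAvg_succ, ← signAvg_add, div_eq_inv_mul, ← signAvg_const_mul]
    simp only [Fin.sum_univ_succ, Fin.cons_zero, Fin.cons_succ]
    refine le_trans (signAvg_mono (g := fun ε => |a 0| ^ q +
      |∑ i : Fin k, boolSign (ε i) * a i.succ| ^ q) fun ε => ?_) ?_
    · refine le_trans (le_of_eq ?_) (abs_add_rpow_add_abs_sub_rpow_le hq.le hq2 _ _)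
      simp [div_eq_inv_mul]
    · rw [signAvg_add, signAvg_const]
      gcongr

section vecLpNorm

variable {ι : Type*} [Fintype ι]

lemma vecLpNorm_ofReal {q : ℝ} (hq : 0 ≤ q) (w : ι → ℝ) :
    vecLpNorm (ENNReal.ofReal q) w = (∑ j, |w j| ^ q) ^ (1 / q) := by
  simp [vecLpNorm, ENNReal.toReal_ofReal hq]

lemma vecLpNorm_nonneg (p : ℝ≥0∞) (w : ι → ℝ) : 0 ≤ vecLpNorm p w := by
  unfold vecLpNorm
  split_ifs
  · exact Real.iSup_nonneg fun _ => abs_nonneg _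
  · positivity

lemma abs_le_vecLpNorm {p : ℝ≥0∞} (hp : p ≠ 0) (w : ι → ℝ) (j : ι) : |w j| ≤ vecLpNorm p w := by
  unfold vecLpNorm
  split_ifs with h
  · exact le_ciSup (f := fun j => |w j|) (Set.finite_range _).bddAbove j
  · have hq := ENNReal.toReal_pos hp h
    calc |w j| = (|w j| ^ p.toReal) ^ (1 / p.toReal) := by
          rw [← Real.rpow_mul (abs_nonneg _), mul_one_div_cancel hq.ne', Real.rpow_one]
      _ ≤ _ := by
          gcongr
          exact Finset.single_le_sum (f := fun j => |w j| ^ p.toReal)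
            (fun _ _ => by positivity) (Finset.mem_univ j)

lemma vecLpNorm_rpow {q : ℝ} (hq : 0 < q) (w : ι → ℝ) :
    vecLpNorm (ENNReal.ofReal q) w ^ q = ∑ j, |w j| ^ q := by
  rw [vecLpNorm_ofReal hq.le, ← Real.rpow_mul (by positivity), one_div_mul_cancel hq.ne',
    Real.rpow_one]

lemma vecLpNorm_anti {r : ℝ} (hr : 0 < r) {p : ℝ≥0∞} (hrp : ENNReal.ofReal r ≤ p) (w : ι → ℝ) :
    vecLpNorm p w ≤ vecLpNorm (ENNReal.ofReal r) w := by
  have hr0 : ENNReal.ofReal r ≠ 0 := by simpa using hr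
  set B := vecLpNorm (ENNReal.ofReal r) w with hB
  have hB0 : 0 ≤ B := vecLpNorm_nonneg _ _
  by_cases h : p = ∞
  · rw [vecLpNorm, if_pos h]
    exact Real.iSup_le (fun j => abs_le_vecLpNorm hr0 w j) hB0
  have hrq : r ≤ p.toReal := (ENNReal.ofReal_le_iff_le_toReal h).1 hrp
  have hq : 0 < p.toReal := hr.trans_le hrq
  rw [vecLpNorm, if_neg h]
  have hsum : ∑ j, |w j| ^ p.toReal ≤ B ^ p.toReal := by
    have hsplit : ∀ x : ℝ, 0 ≤ x → x ^ p.toReal = x ^ r * x ^ (p.toReal - r) := fun x hx => by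
      rw [← Real.rpow_add_of_nonneg hx hr.le (by linarith)]
      ring_nf
    rw [hsplit B hB0, vecLpNorm_rpow hr, Finset.sum_mul]
    refine Finset.sum_le_sum fun j _ => ?_
    rw [hsplit _ (abs_nonneg _)]
    have := abs_le_vecLpNorm hr0 w j
    gcongr
  calc _ ≤ (B ^ p.toReal) ^ (1 / p.toReal) := by gcongr
    _ = B := by rw [← Real.rpow_mul hB0, mul_one_div_cancel hq.ne', Real.rpow_one]

lemma vecLpNorm_le_card_rpow_mul {r : ℝ} (hr : 0 < r) {p : ℝ≥0∞} (hp : p ≠ 0) (w : ι → ℝ) :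
    vecLpNorm (ENNReal.ofReal r) w ≤ (Fintype.card ι : ℝ) ^ (1 / r) * vecLpNorm p w := by
  have hB0 := vecLpNorm_nonneg p w
  rw [vecLpNorm_ofReal hr.le]
  calc _ ≤ (∑ _j : ι, vecLpNorm p w ^ r) ^ (1 / r) := by
        gcongr with j
        exact abs_le_vecLpNorm hp w j
    _ = _ := by
        rw [Finset.sum_const, nsmul_eq_mul, Finset.card_univ,
          Real.mul_rpow (by positivity) (by positivity), ← Real.rpow_mul hB0,
          mul_one_div_cancel hr.ne', Real.rpow_one]

variable {m : ℕ}

lemma signAvg_vecLpNorm_le {q D M : ℝ} (hq : 1 ≤ q) (hD : 0 ≤ D) (hM : 0 ≤ M)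
    (hscalar : ∀ a : Fin m → ℝ,
      signAvg (fun ε => |∑ i, boolSign (ε i) * a i| ^ q) ≤ D * ∑ i, |a i| ^ q)
    {v : Fin m → ι → ℝ} (hv : ∀ i, vecLpNorm (ENNReal.ofReal q) (v i) ≤ M) :
    signAvg (fun ε => vecLpNorm (ENNReal.ofReal q) (∑ i, boolSign (ε i) • v i)) ≤
      (D * m) ^ (1 / q) * M := by
  have hq0 : 0 < q := by linarith
  refine (signAvg_le_rpow_signAvg hq fun _ => vecLpNorm_nonneg _ _).trans ?_
  simp only [vecLpNorm_rpow hq0, signAvg_sum, Finset.sum_apply, Pi.smul_apply, smul_eq_mul]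
  have hsum : ∑ j, signAvg (fun ε => |∑ i, boolSign (ε i) * v i j| ^ q) ≤ D * m * M ^ q := by
    calc _ ≤ ∑ j, D * ∑ i, |v i j| ^ q := Finset.sum_le_sum fun j _ => hscalar _
      _ = D * ∑ i, ∑ j, |v i j| ^ q := by rw [← Finset.mul_sum, Finset.sum_comm]
      _ ≤ D * ∑ _i : Fin m, M ^ q := by
          gcongr with i
          rw [← vecLpNorm_rpow hq0]
          exact Real.rpow_le_rpow (vecLpNorm_nonneg _ _) (hv i) hq0.le
      _ = _ := by simp [mul_assoc]
  calc _ ≤ (D * m * M ^ q) ^ (1 / q) := by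
        refine Real.rpow_le_rpow (Finset.sum_nonneg fun j _ => ?_) hsum (by positivity)
        exact mul_nonneg (by positivity) (Finset.sum_nonneg fun _ _ => by positivity)
    _ = _ := by
        rw [Real.mul_rpow (by positivity) (by positivity), ← Real.rpow_mul hM,
          mul_one_div_cancel hq0.ne', Real.rpow_one]

lemma signAvg_vecLpNorm_le_of_two_le {q M : ℝ} (hq : 2 ≤ q) (hm : 1 ≤ m) (hM : 0 ≤ M)
    {v : Fin m → ι → ℝ} (hv : ∀ i, vecLpNorm (ENNReal.ofReal q) (v i) ≤ M) :
    signAvg (fun ε => vecLpNorm (ENNReal.ofReal q) (∑ i, boolSign (ε i) • v i)) ≤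
      2 ^ (1 / q) * √(q / Real.exp 1) * √m * M := by
  have hq0 : 0 < q := by linarith
  have hm0 : (0 : ℝ) < m := by exact_mod_cast hm
  refine (signAvg_vecLpNorm_le (D := 2 * (q / Real.exp 1) ^ (q / 2) * (m : ℝ) ^ (q / 2 - 1))
    (by linarith) (by positivity) hM (fun a => ?_) hv).trans (le_of_eq ?_)
  · refine (signAvg_abs_rpow_le hq0 a).trans ?_
    rw [mul_assoc _ ((m : ℝ) ^ _)]
    gcongr
    exact sum_sq_rpow_le hq a
  · have e : (m : ℝ) ^ (q / 2 - 1) * m = (m : ℝ) ^ (q / 2) := by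
      rw [Real.rpow_sub_one hm0.ne']
      field_simp
    have e' : q / 2 * (1 / q) = 1 / 2 := by field_simp
    rw [mul_assoc _ _ (m : ℝ), e, Real.mul_rpow (by positivity) (by positivity),
      Real.mul_rpow (by positivity) (by positivity), ← Real.rpow_mul (by positivity),
      ← Real.rpow_mul hm0.le, e', Real.sqrt_eq_rpow, Real.sqrt_eq_rpow]

end vecLpNorm

lemma two_rpow_le_sqrt_exp {x : ℝ} (hx : x ≤ 1 / 2) : (2 : ℝ) ^ x ≤ √(Real.exp 1) := by
  have h2 : (2 : ℝ) ≤ Real.exp 1 := by linarith [Real.add_one_le_exp (1 : ℝ)]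
  calc (2 : ℝ) ^ x ≤ 2 ^ (1 / 2 : ℝ) := Real.rpow_le_rpow_of_exponent_le (by norm_num) hx
    _ ≤ _ := by
      rw [← Real.sqrt_eq_rpow]
      exact Real.sqrt_le_sqrt h2

lemma two_rpow_mul_sqrt_div_exp_le {x : ℝ} (hx : x ≤ 1 / 2) {q : ℝ} (hq : 0 ≤ q) :
    (2 : ℝ) ^ x * √(q / Real.exp 1) ≤ √q := by
  have := two_rpow_le_sqrt_exp hx
  rw [Real.sqrt_div hq, mul_div_assoc', div_le_iff₀ (by positivity), mul_comm]
  gcongr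

section signAvg_min

variable {m n₀ : ℕ} {v : Fin m → Fin (4 ^ n₀) → ℝ} {M : ℝ}

lemma signAvg_vecLpNorm_le_sqrt (hm : 1 ≤ m) (hM : 0 ≤ M) {q : ℝ} (hq : 2 ≤ q)
    (hv : ∀ i, vecLpNorm (ENNReal.ofReal q) (v i) ≤ M) :
    signAvg (fun ε => vecLpNorm (ENNReal.ofReal q) (∑ i, boolSign (ε i) • v i)) ≤
      √q * √m * M := by
  refine (signAvg_vecLpNorm_le_of_two_le hq hm hM hv).trans ?_
  have := two_rpow_mul_sqrt_div_exp_le (x := 1 / q)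
    (one_div_le_one_div_of_le (by norm_num) hq) (q := q) (by linarith)
  gcongr

lemma signAvg_vecLpNorm_le_sqrt_dim (hn₀ : 1 ≤ n₀) (hm : 1 ≤ m) (hM : 0 ≤ M) {p : ℝ≥0∞}
    (hp : ENNReal.ofReal (8 * n₀) ≤ p) (hv : ∀ i, vecLpNorm p (v i) ≤ M) :
    signAvg (fun ε => vecLpNorm p (∑ i, boolSign (ε i) • v i)) ≤ √(8 * n₀) * √m * M := by
  have hn : (1 : ℝ) ≤ n₀ := by exact_mod_cast hn₀
  have hr : (0 : ℝ) < 8 * n₀ := by positivity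
  have hp0 : p ≠ 0 := ((ENNReal.ofReal_pos.2 hr).trans_le hp).ne'
  have hcard : ((4 ^ n₀ : ℕ) : ℝ) ^ (1 / (8 * n₀ : ℝ)) = 2 ^ (1 / 4 : ℝ) := by
    have h4 : ((4 ^ n₀ : ℕ) : ℝ) = 2 ^ (2 * n₀ : ℝ) := by
      rw [Real.rpow_mul (by norm_num), Real.rpow_natCast]
      norm_num
    rw [h4, ← Real.rpow_mul (by norm_num)]
    congr 1
    field_simp
    norm_num
  have hv' : ∀ i, vecLpNorm (ENNReal.ofReal (8 * n₀)) (v i) ≤ 2 ^ (1 / 4 : ℝ) * M := fun i => by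
    have h := vecLpNorm_le_card_rpow_mul hr hp0 (v i)
    rw [Fintype.card_fin, hcard] at h
    exact h.trans (by gcongr; exact hv i)
  refine (signAvg_mono fun ε => vecLpNorm_anti hr hp _).trans ?_
  refine (signAvg_vecLpNorm_le_of_two_le (by linarith) hm (by positivity) hv').trans ?_
  have hx : 1 / (8 * n₀ : ℝ) + 1 / 4 ≤ 1 / 2 := by
    have : 1 / (8 * n₀ : ℝ) ≤ 1 / 8 := one_div_le_one_div_of_le (by norm_num) (by linarith)
    linarith
  have h := two_rpow_mul_sqrt_div_exp_le hx hr.le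
  rw [Real.rpow_add (by norm_num)] at h
  calc _ = 2 ^ (1 / (8 * n₀ : ℝ)) * 2 ^ (1 / 4 : ℝ) * √(8 * n₀ / Real.exp 1) * √m * M := by ring
    _ ≤ _ := by gcongr

end signAvg_min

/-- Rademacher averages of `l_{p*}` norms of signed vector sums: for `1 ≤ p ≤ 2`,
the average of `(1/m)‖∑ εᵢ vᵢ‖_{p*}` is at most `√(min{p*, 8n₀})/√m · maxᵢ ‖vᵢ‖_{p*}`,
and for `2 < p < ∞` it is at most `√(p*)/m^{1/p} · maxᵢ ‖vᵢ‖_{p*}`. -/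
theorem statement15 (n₀ m : ℕ) (hn₀ : 1 ≤ n₀) (hm : 1 ≤ m)
    (v : Fin m → Fin (4 ^ n₀) → ℝ) :
    (∀ p : ℝ, 1 ≤ p → p ≤ 2 →
      ((2 : ℝ) ^ m)⁻¹ * ∑ ε : Fin m → Bool, (m : ℝ)⁻¹ *
          vecLpNorm (hconj p) (∑ i, (if ε i then (1 : ℝ) else -1) • v i) ≤
        (Real.sqrt (minConj p n₀) / Real.sqrt (m : ℝ)) *
          (⨆ i, vecLpNorm (hconj p) (v i))) ∧
    (∀ p : ℝ, 2 < p →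
      ((2 : ℝ) ^ m)⁻¹ * ∑ ε : Fin m → Bool, (m : ℝ)⁻¹ *
          vecLpNorm (hconj p) (∑ i, (if ε i then (1 : ℝ) else -1) • v i) ≤
        (Real.sqrt (p / (p - 1)) / (m : ℝ) ^ (1 / p)) *
          (⨆ i, vecLpNorm (hconj p) (v i))) := by
  have hm0 : (0 : ℝ) < m := by exact_mod_cast hm
  have hle : ∀ P : ℝ≥0∞, ∀ i, vecLpNorm P (v i) ≤ ⨆ i, vecLpNorm P (v i) := fun P i =>
    le_ciSup (f := fun i => vecLpNorm P (v i)) (Set.finite_range _).bddAbove i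
  have hM : ∀ P : ℝ≥0∞, 0 ≤ ⨆ i, vecLpNorm P (v i) := fun P =>
    Real.iSup_nonneg fun _ => vecLpNorm_nonneg _ _
  have havg : ∀ P : ℝ≥0∞, ((2 : ℝ) ^ m)⁻¹ * ∑ ε : Fin m → Bool, (m : ℝ)⁻¹ *
      vecLpNorm P (∑ i, (if ε i then (1 : ℝ) else -1) • v i) =
      (m : ℝ)⁻¹ * signAvg (fun ε => vecLpNorm P (∑ i, boolSign (ε i) • v i)) := fun P =>
    signAvg_const_mul _ _
  have hscale : ∀ (P : ℝ≥0∞) (c : ℝ),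
      signAvg (fun ε => vecLpNorm P (∑ i, boolSign (ε i) • v i)) ≤
        c * √m * (⨆ i, vecLpNorm P (v i)) →
      (m : ℝ)⁻¹ * signAvg (fun ε => vecLpNorm P (∑ i, boolSign (ε i) • v i)) ≤
        c / √m * (⨆ i, vecLpNorm P (v i)) := fun P c h => by
    calc _ ≤ (m : ℝ)⁻¹ * (c * √m * (⨆ i, vecLpNorm P (v i))) := by gcongr
      _ = _ := by
        have hs : √(m : ℝ) / m = 1 / √m := by
          rw [Real.sqrt_div_self', one_div]
        linear_combination c * (⨆ i, vecLpNorm P (v i)) * hs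
  refine ⟨fun p hp1 hp2 => ?_, fun p hp => ?_⟩
  · rw [havg]
    refine hscale _ _ ?_
    rcases hp1.eq_or_lt with rfl | hp1
    · simp only [hconj, minConj, if_true]
      exact signAvg_vecLpNorm_le_sqrt_dim hn₀ hm (hM _) le_top (hle _)
    · have hq : 2 ≤ p / (p - 1) := by
        rw [le_div_iff₀ (by linarith)]
        linarith
      simp only [hconj, minConj, if_neg hp1.ne']
      rcases le_total (p / (p - 1)) (8 * n₀) with h | h
      · rw [min_eq_left h]
        exact signAvg_vecLpNorm_le_sqrt hm (hM _) hq (hle _)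
      · rw [min_eq_right h]
        exact signAvg_vecLpNorm_le_sqrt_dim hn₀ hm (hM _) (ENNReal.ofReal_le_ofReal h) (hle _)
  · have hp1 : 0 < p - 1 := by linarith
    have hq1 : 1 ≤ p / (p - 1) := by
      rw [le_div_iff₀ hp1]
      linarith
    have hq2 : p / (p - 1) ≤ 2 := by
      rw [div_le_iff₀ hp1]
      linarith
    rw [havg, hconj, if_neg (by linarith)]
    have h := signAvg_vecLpNorm_le (D := 1) hq1 zero_le_one (hM _)
      (fun a => by simpa using signAvg_abs_rpow_le_sum (by linarith) hq2 a)
      (hle (ENNReal.ofReal (p / (p - 1))))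
    have hpow : (m : ℝ)⁻¹ * (1 * m : ℝ) ^ (1 / (p / (p - 1))) = 1 / (m : ℝ) ^ (1 / p) := by
      have e : 1 / (p / (p - 1)) = 1 - 1 / p := by
        have : p ≠ 0 := by linarith
        field_simp
      rw [one_mul, e, Real.rpow_sub hm0, Real.rpow_one]
      field_simp
    have hs : 1 ≤ √(p / (p - 1)) := Real.one_le_sqrt.2 hq1
    have hM' := hM (ENNReal.ofReal (p / (p - 1)))
    calc _ ≤ _ := mul_le_mul_of_nonneg_left h (by positivity)
      _ = 1 / (m : ℝ) ^ (1 / p) * _ := by rw [← mul_assoc, hpow]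
      _ ≤ _ := by gcongr
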